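/- Let G = G_{m,n} = S_m □ P_n with m odd, m > 3, and n even. Then rn(G) ≤ (m n²)/2 + n − 1. -/

import Mathlib

/-- The star graph on `m` vertices with center `0`. -/
def starGraph (m : ℕ) : SimpleGraph (Fin m) :=
  SimpleGraph.fromRel (fun a _ => (a : ℕ) = 0)

/-- The path graph on `n` vertices `0, 1, …, n-1`. -/
def pathGraph' (n : ℕ) : SimpleGraph (Fin n) :=
  SimpleGraph.fromRel (fun a b => (a : ℕ) + 1 = b)

/-- The stacked-book graph `G_{m,n} = S_m □ P_n`. -/
def bookGraph (m n : ℕ) : SimpleGraph (Fin m × Fin n) :=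
  (starGraph m).boxProd (pathGraph' n)

/-- `f` is a radio labeling of `G` for diameter `D`:
`|f u - f v| ≥ D + 1 - d(u,v)` for all distinct `u, v`. -/
def IsRadioLabeling {V : Type*} (G : SimpleGraph V) (D : ℕ) (f : V → ℕ) : Prop :=
  ∀ u v : V, u ≠ v → (D : ℤ) + 1 - G.dist u v ≤ |(f u : ℤ) - (f v : ℤ)|

/-- The span of a labeling: maximum label minus minimum label. -/
noncomputable def span {V : Type*} (f : V → ℕ) : ℕ :=
  sSup (Set.range f) - sInf (Set.range f)

/-- The radio number of the stacked-book graph `G_{m,n}` (whose diameter is `n+1`). -/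
noncomputable def rnBook (m n : ℕ) : ℕ :=
  sInf {s | ∃ f : Fin m × Fin n → ℕ, IsRadioLabeling (bookGraph m n) (n + 1) f ∧ span f = s}

/-- The distance between two vertices of a star with center `0`. -/
def starDist (a b : ℕ) : ℕ := if a = b then 0 else if a = 0 ∨ b = 0 then 1 else 2

lemma starDist_le_add_one {m : ℕ} {a b : Fin m} (h : (starGraph m).Adj a b) (c : ℕ) :
    starDist a c ≤ starDist b c + 1 := by
  rw [starGraph, SimpleGraph.fromRel_adj] at h
  unfold starDist
  split_ifs <;> omega

lemma bookGraph_adj_bound {m n : ℕ} {u v : Fin m × Fin n} (h : (bookGraph m n).Adj u v)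
    (w : Fin m × Fin n) :
    (starDist u.1 w.1 : ℤ) + ((u.2 : ℤ) - (w.2 : ℤ)).natAbs
      ≤ starDist v.1 w.1 + ((v.2 : ℤ) - (w.2 : ℤ)).natAbs + 1 := by
  rw [bookGraph, SimpleGraph.boxProd_adj] at h
  rcases h with ⟨h, he⟩ | ⟨h, he⟩
  · have := starDist_le_add_one h w.1
    rw [he]
    omega
  · rw [pathGraph', SimpleGraph.fromRel_adj] at h
    rw [he]
    omega

lemma bookGraph_walk_bound {m n : ℕ} {u v : Fin m × Fin n} (p : (bookGraph m n).Walk u v) :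
    (starDist u.1 v.1 : ℤ) + ((u.2 : ℤ) - (v.2 : ℤ)).natAbs ≤ p.length := by
  induction p with
  | nil => simp [starDist]
  | @cons u v w h p ih =>
    have := bookGraph_adj_bound h w
    rw [SimpleGraph.Walk.length_cons]
    push_cast [-Int.natCast_natAbs]
    omega

lemma starGraph_preconnected (m : ℕ) : (starGraph m).Preconnected := by
  have key : ∀ (h : 0 < m) (a : Fin m), (starGraph m).Reachable ⟨0, h⟩ a := by
    intro h a
    by_cases ha : (⟨0, h⟩ : Fin m) = a
    · rw [ha]
    · refine SimpleGraph.Adj.reachable ?_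
      rw [starGraph, SimpleGraph.fromRel_adj]
      exact ⟨ha, Or.inl rfl⟩
  intro a b
  exact (key a.pos a).symm.trans (key a.pos b)

lemma pathGraph'_preconnected (n : ℕ) : (pathGraph' n).Preconnected := by
  have key : ∀ (i : ℕ) (hi : i < n),
      (pathGraph' n).Reachable ⟨0, Nat.zero_lt_of_lt hi⟩ ⟨i, hi⟩ := by
    intro i
    induction i with
    | zero => exact fun hi => SimpleGraph.Reachable.refl _
    | succ i ih =>
      intro hi
      refine (ih (by omega)).trans (SimpleGraph.Adj.reachable ?_)
      rw [pathGraph', SimpleGraph.fromRel_adj]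
      exact ⟨by simp, Or.inl rfl⟩
  intro a b
  exact (key a a.2).symm.trans (key b b.2)

lemma le_bookGraph_dist {m n : ℕ} (u v : Fin m × Fin n) :
    (starDist u.1 v.1 : ℤ) + ((u.2 : ℤ) - (v.2 : ℤ)).natAbs ≤ (bookGraph m n).dist u v := by
  have hr : (bookGraph m n).Reachable u v :=
    (starGraph_preconnected m).boxProd (pathGraph'_preconnected n) u v
  obtain ⟨p, hp⟩ := hr.exists_walk_length_eq_dist
  rw [← hp]
  exact bookGraph_walk_bound p

/-- The block of the vertex ordering that contains a vertex of level `i`, for `2 * k` levels. -/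
def bookBlock (k i : ℕ) : ℕ := if i < k then k - 1 - i else 2 * k - 1 - i

/-- The position of the vertex `(a, i)` inside its block of `2 * m` vertices. -/
def bookOffset (m k a i : ℕ) : ℕ :=
  if i < k then (if a % 2 = 0 then a else a + m)
  else if a % 2 = 1 then a
  else if i = k then (if a = 0 then 2 * m - 1 else a + m - 2)
  else a + m

/-- The correction to a labeling with constant gaps `k`, at offset `r` of block `q`. -/
def bookCorrection (m k q r : ℕ) : ℕ :=
  3 * q + if r = 0 then 0
    else if q + 1 = k then (if r + 1 = 2 * m then 2 else 1)
    else if r < m then 1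
    else if r = m then 2
    else 3

/-- The radio labeling of the stacked-book graph with `2 * k` levels. -/
def bookLabel (m k : ℕ) (v : Fin m × Fin (2 * k)) : ℕ :=
  k * (2 * (m * bookBlock k v.2) + bookOffset m k v.1 v.2) +
    bookCorrection m k (bookBlock k v.2) (bookOffset m k v.1 v.2)

lemma bookCorrection_mono {m k q r q' r' : ℕ} (hr' : r' < 2 * m) (hq' : q' < k)
    (h : q < q' ∨ q = q' ∧ r ≤ r') : bookCorrection m k q r ≤ bookCorrection m k q' r' := by
  unfold bookCorrection
  split_ifs <;> omega

lemma bookBlock_lt {k i : ℕ} (hi : i < 2 * k) : bookBlock k i < k := by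
  unfold bookBlock
  split_ifs <;> omega

lemma bookOffset_lt {m k a i : ℕ} (hmo : m % 2 = 1) (ha : a < m) :
    bookOffset m k a i < 2 * m := by
  unfold bookOffset
  split_ifs <;> omega

lemma book_step_one {m k a i b j : ℕ} (hm : 3 < m) (hmo : m % 2 = 1) (ha : a < m) (hb : b < m)
    (hi : i < 2 * k) (hj : j < 2 * k)
    (h : bookBlock k i = bookBlock k j ∧ bookOffset m k b j = bookOffset m k a i + 1 ∨
      bookBlock k j = bookBlock k i + 1 ∧
        bookOffset m k b j + 2 * m = bookOffset m k a i + 1) :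
    (k : ℤ) + 2 + bookCorrection m k (bookBlock k i) (bookOffset m k a i)
      ≤ bookCorrection m k (bookBlock k j) (bookOffset m k b j) + starDist a b
        + ((i : ℤ) - j).natAbs := by
  unfold bookBlock bookOffset at *
  unfold bookCorrection starDist
  grind (splits := 40)

lemma book_step_two {m k a i b j : ℕ} (hm : 3 < m) (hmo : m % 2 = 1) (ha : a < m) (hb : b < m)
    (hi : i < 2 * k) (hj : j < 2 * k)
    (h : bookBlock k i = bookBlock k j ∧ bookOffset m k b j = bookOffset m k a i + 2 ∨
      bookBlock k j = bookBlock k i + 1 ∧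
        bookOffset m k b j + 2 * m = bookOffset m k a i + 2) :
    2 + (bookCorrection m k (bookBlock k i) (bookOffset m k a i) : ℤ)
      ≤ bookCorrection m k (bookBlock k j) (bookOffset m k b j) + starDist a b
        + ((i : ℤ) - j).natAbs := by
  unfold bookBlock bookOffset at *
  unfold bookCorrection starDist
  grind (splits := 40)

lemma bookBlock_bookOffset_injective {m k : ℕ} (hm : 3 < m) (hmo : m % 2 = 1)
    {u v : Fin m × Fin (2 * k)} (hq : bookBlock k u.2 = bookBlock k v.2)
    (hr : bookOffset m k u.1 u.2 = bookOffset m k v.1 v.2) : u = v := by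
  obtain ⟨⟨a, ha⟩, ⟨i, hi⟩⟩ := u
  obtain ⟨⟨b, hb⟩, ⟨j, hj⟩⟩ := v
  simp only [Prod.mk.injEq, Fin.mk.injEq] at *
  unfold bookBlock at hq
  unfold bookOffset at hr
  split_ifs at * <;> omega

lemma bookLabel_gap {m k : ℕ} (hm : 3 < m) (hmo : m % 2 = 1)
    {u v : Fin m × Fin (2 * k)} (huv : u ≠ v)
    (h : 2 * (m * bookBlock k u.2) + bookOffset m k u.1 u.2
      ≤ 2 * (m * bookBlock k v.2) + bookOffset m k v.1 v.2) :
    2 * (k : ℤ) + 2 + bookLabel m k u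
      ≤ bookLabel m k v + starDist u.1 v.1 + ((u.2 : ℤ) - (v.2 : ℤ)).natAbs := by
  have hinj := mt (fun h : _ ∧ _ => bookBlock_bookOffset_injective hm hmo h.1 h.2) huv
  have one := book_step_one hm hmo u.1.2 v.1.2 u.2.2 v.2.2
  have two := book_step_two hm hmo u.1.2 v.1.2 u.2.2 v.2.2
  have hr := bookOffset_lt (k := k) (i := u.2) hmo u.1.2
  have hr' := bookOffset_lt (k := k) (i := v.2) hmo v.1.2
  have hq := bookBlock_lt u.2.2
  have hq' := bookBlock_lt v.2.2
  have mono := bookCorrection_mono (r := bookOffset m k u.1 u.2)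
    (q := bookBlock k u.2) hr' hq'
  have hD : 1 ≤ (starDist u.1 v.1 : ℤ) + ((u.2 : ℤ) - (v.2 : ℤ)).natAbs := by
    by_contra hD
    refine huv (Prod.ext (Fin.ext ?_) (Fin.ext ?_))
    · by_contra hne
      unfold starDist at hD
      split_ifs at hD <;> omega
    · omega
  unfold bookLabel
  generalize bookBlock k u.2 = q at *
  generalize bookBlock k v.2 = q' at *
  generalize bookOffset m k u.1 u.2 = r at *
  generalize bookOffset m k v.1 v.2 = r' at *
  have hcases : q = q' ∨ q' = q + 1 ∨ q + 2 ≤ q' := by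
    by_contra hcon
    have h1 : q' + 1 ≤ q := by omega
    have := Nat.mul_le_mul_left m h1
    rw [Nat.mul_add] at this
    omega
  have hmono := mono (by
    rcases hcases with hc | hc
    · subst hc
      omega
    · omega)
  obtain ⟨d, hd⟩ := Nat.exists_eq_add_of_le h
  rw [hd, Nat.mul_add k _ d]
  have hstep : (q = q' ∧ r' = r + d) ∨ (q' = q + 1 ∧ r' + 2 * m = r + d) ∨ 3 ≤ d := by
    rcases hcases with hc | hc | hc
    · subst hc
      omega
    · subst hc
      rw [Nat.mul_add] at hd
      omega
    · have := Nat.mul_le_mul_left m hc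
      rw [Nat.mul_add] at this
      omega
  rcases Nat.lt_or_ge d 3 with hlt | hge
  · interval_cases d
    · omega
    · have := one (by omega)
      push_cast [-Int.natCast_natAbs]
      omega
    · have := two (by omega)
      push_cast [-Int.natCast_natAbs]
      omega
  · have := Nat.mul_le_mul_left k hge
    push_cast [-Int.natCast_natAbs]
    omega

lemma bookLabel_isRadioLabeling {m k : ℕ} (hm : 3 < m) (hmo : m % 2 = 1) :
    IsRadioLabeling (bookGraph m (2 * k)) (2 * k + 1) (bookLabel m k) := by
  intro u v huv
  have hd := le_bookGraph_dist u v
  have hd' := le_bookGraph_dist v u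
  rw [SimpleGraph.dist_comm] at hd'
  rw [Int.abs_eq_natAbs]
  push_cast [-Int.natCast_natAbs]
  rcases le_total (2 * (m * bookBlock k u.2) + bookOffset m k u.1 u.2)
    (2 * (m * bookBlock k v.2) + bookOffset m k v.1 v.2) with h | h
  · have := bookLabel_gap hm hmo huv h
    omega
  · have := bookLabel_gap hm hmo huv.symm h
    omega

lemma bookLabel_le {m k : ℕ} (hmo : m % 2 = 1) (v : Fin m × Fin (2 * k)) :
    bookLabel m k v ≤ 2 * (m * k ^ 2) + 2 * k - 1 := by
  have hr := bookOffset_lt (k := k) (i := v.2) hmo v.1.2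
  have hq := bookBlock_lt v.2.2
  unfold bookLabel
  generalize bookBlock k v.2 = q at *
  generalize bookOffset m k v.1 v.2 = r at *
  have hc : bookCorrection m k q r ≤ 3 * k - 1 := by
    unfold bookCorrection
    split_ifs <;> omega
  have ht : 2 * (m * q) + r + 1 ≤ 2 * (m * k) := by
    have := Nat.mul_le_mul_left m hq
    rw [Nat.succ_eq_add_one, Nat.mul_add] at this
    omega
  have hk := Nat.mul_le_mul_left k ht
  rw [Nat.mul_add] at hk
  have : k * (2 * (m * k)) = 2 * (m * k ^ 2) := by ring
  omega

theorem rnBook_upper_bound_m_odd (m n : ℕ) (hm : 3 < m) (hmo : Odd m)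
    (hn : Even n) (hn2 : 2 ≤ n) :
    rnBook m n ≤ m * n ^ 2 / 2 + n - 1 := by
  obtain ⟨k, rfl⟩ := even_iff_two_dvd.mp hn
  have hodd := Nat.odd_iff.mp hmo
  have hspan : span (bookLabel m k) ≤ 2 * (m * k ^ 2) + 2 * k - 1 := by
    refine (Nat.sub_le _ _).trans (csSup_le' ?_)
    rintro _ ⟨v, rfl⟩
    exact bookLabel_le hodd v
  have hval : m * (2 * k) ^ 2 / 2 = 2 * (m * k ^ 2) := by
    rw [show m * (2 * k) ^ 2 = 2 * (2 * (m * k ^ 2)) by ring]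
    simp
  rw [hval]
  refine (Nat.sInf_le ?_).trans hspan
  exact ⟨_, bookLabel_isRadioLabeling hm hodd, rfl⟩
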